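/- Let σ be a signature and H a ⋆-structure over σ. Then Obs_01^⊂(H) = Obs_01^→(H): a 01-structure G is an inclusion-minimal obstruction for MP_01(H) if and only if G is a hom-minimal obstruction for MP_01(H). -/

import Mathlib

/-- The four possible values of a `∅`-structure: `∅`, `0`, `1`, `⋆`. -/
inductive MPV : Type
  | emp : MPV
  | zero : MPV
  | one : MPV
  | star : MPV
  deriving DecidableEq

/-- The partial order `≼_∅` on `{∅,0,1,⋆}`: `∅ ≼ 0 ≼ ⋆`, `∅ ≼ 1 ≼ ⋆`, with `0,1` incomparable.
Restricted to `{0,1,⋆}` it is `≼_⋆`, and restricted to `{0,1}` it is the empty (discrete)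
order `≼_01`. -/
def MPV.le : MPV → MPV → Prop := fun a b => a = b ∨ a = MPV.emp ∨ b = MPV.star

instance (a b : MPV) : Decidable (MPV.le a b) := by
  unfold MPV.le; infer_instance

/-- A `(P_∅, σ)`-structure, where the signature `σ` has symbols indexed by `ι`,
the symbol `i` having arity `ar i`. -/
structure MPStruct (ι : Type) (ar : ι → ℕ) : Type 1 where
  carrier : Type
  [finCarrier : Fintype carrier]
  rel : ∀ i : ι, (Fin (ar i) → carrier) → MPV

attribute [instance] MPStruct.finCarrier

variable {ι : Type} {ar : ι → ℕ}

/-- `h` is a homomorphism from `G` to `H`. -/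
def IsHom (G H : MPStruct ι ar) (h : G.carrier → H.carrier) : Prop :=
  ∀ (i : ι) (t : Fin (ar i) → G.carrier), MPV.le (G.rel i t) (H.rel i (h ∘ t))

/-- There exists a homomorphism from `G` to `H`. -/
def Hom (G H : MPStruct ι ar) : Prop := ∃ h, IsHom G H h

/-- `h` is an isomorphism from `G` to `H`. -/
def IsIsoMap (G H : MPStruct ι ar) (h : G.carrier → H.carrier) : Prop :=
  Function.Bijective h ∧
    ∀ (i : ι) (t : Fin (ar i) → G.carrier), H.rel i (h ∘ t) = G.rel i t

/-- `G` and `H` are isomorphic. -/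
def Iso (G H : MPStruct ι ar) : Prop := ∃ h, IsIsoMap G H h

/-- `G` is a core: every endo-homomorphism is an isomorphism. -/
def IsCore (G : MPStruct ι ar) : Prop := ∀ h, IsHom G G h → IsIsoMap G G h

/-- `G` is a `01`-structure: all values are in `{0,1}`. -/
def MPStruct.is01 (G : MPStruct ι ar) : Prop :=
  ∀ (i : ι) (t : Fin (ar i) → G.carrier),
    G.rel i t = MPV.zero ∨ G.rel i t = MPV.one

/-- `G` is a `⋆`-structure: all values are in `{0,1,⋆}`. -/
def MPStruct.isStar (G : MPStruct ι ar) : Prop :=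
  ∀ (i : ι) (t : Fin (ar i) → G.carrier), G.rel i t ≠ MPV.emp

/-- The induced substructure `G ∖ {v}`. -/
noncomputable def MPStruct.delete (G : MPStruct ι ar) (v : G.carrier) :
    MPStruct ι ar where
  carrier := {x : G.carrier // x ≠ v}
  finCarrier := by classical exact inferInstance
  rel := fun i t => G.rel i fun j => (t j).1

/-- `G` is an inclusion-minimal obstruction for `MP_P(H)`, where `P` cuts out the class of
input structures (`01`-, `⋆`- or `∅`-structures). -/
def InclMinObs (P : MPStruct ι ar → Prop) (H G : MPStruct ι ar) : Prop :=
  P G ∧ ¬ Hom G H ∧ ∀ v : G.carrier, Hom (G.delete v) H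

/-- `G` is a hom-minimal obstruction for `MP_P(H)`. -/
def HomMinObs (P : MPStruct ι ar → Prop) (H G : MPStruct ι ar) : Prop :=
  P G ∧ IsCore G ∧ ¬ Hom G H ∧
    ∀ G' : MPStruct ι ar, P G' → Hom G' G → ¬ Hom G G' → Hom G' H

/-- The class `S` contains only finitely many isomorphism classes. -/
def FinitelyManyUpToIso (S : MPStruct ι ar → Prop) : Prop :=
  ∃ L : List (MPStruct ι ar), ∀ G, S G → ∃ G' ∈ L, Iso G G'

/-- The three classes of structures `01` (`s = 0`), `⋆` (`s = 1`) and `∅` (`s = 2`). -/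
def ClassPred (s : Fin 3) : MPStruct ι ar → Prop :=
  if s = 0 then MPStruct.is01 else if s = 1 then MPStruct.isStar else fun _ => True

theorem MPV.le.trans {a b c : MPV} (hab : MPV.le a b) (hbc : MPV.le b c) : MPV.le a c := by
  cases a <;> cases b <;> cases c <;> simp_all [MPV.le]

theorem IsHom.comp {G K L : MPStruct ι ar} {f : G.carrier → K.carrier}
    {g : K.carrier → L.carrier} (hg : IsHom K L g) (hf : IsHom G K f) : IsHom G L (g ∘ f) :=
  fun i t => (hf i t).trans (hg i (f ∘ t))

theorem Hom.trans {G K L : MPStruct ι ar} : Hom G K → Hom K L → Hom G L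
  | ⟨f, hf⟩, ⟨g, hg⟩ => ⟨g ∘ f, hg.comp hf⟩

theorem isHom_delete_val (G : MPStruct ι ar) (v : G.carrier) :
    IsHom (G.delete v) G (fun x : {x : G.carrier // x ≠ v} => x.1) :=
  fun _ _ => Or.inl rfl

theorem MPStruct.is01.delete {G : MPStruct ι ar} (hG : G.is01) (v : G.carrier) :
    (G.delete v).is01 :=
  fun i t => hG i fun j => (t j).1

/-- A homomorphism avoiding `v` factors through `G ∖ {v}`. -/
theorem IsHom.hom_delete {K G : MPStruct ι ar} {f : K.carrier → G.carrier} (hf : IsHom K G f)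
    {v : G.carrier} (hv : ∀ x, f x ≠ v) : Hom K (G.delete v) :=
  ⟨fun x => ⟨f x, hv x⟩, hf⟩

/-- Homomorphisms between `01`-structures preserve all values exactly. -/
theorem IsHom.rel_eq {K G : MPStruct ι ar} (hK : K.is01) (hG : G.is01)
    {f : K.carrier → G.carrier} (hf : IsHom K G f) (i : ι) (t : Fin (ar i) → K.carrier) :
    G.rel i (f ∘ t) = K.rel i t := by
  have h := hf i t
  rcases hK i t with h₁ | h₁ <;> rcases hG i (f ∘ t) with h₂ | h₂ <;>
    simp_all [MPV.le]

/-- Every section of a surjective homomorphism of `01`-structures is a homomorphism. -/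
theorem IsHom.hom_of_surjective {K G : MPStruct ι ar} (hK : K.is01) (hG : G.is01)
    {f : K.carrier → G.carrier} (hf : IsHom K G f) (hs : Function.Surjective f) : Hom G K := by
  obtain ⟨s, hs⟩ := hs.hasRightInverse
  refine ⟨s, fun i t => Or.inl ?_⟩
  rw [← hf.rel_eq hK hG, ← Function.comp_assoc, hs.comp_eq_id, Function.id_comp]

/-- A structure mapping to an inclusion-minimal obstruction without mapping to `H` does so
only by surjections. -/
theorem InclMinObs.surjective {P : MPStruct ι ar → Prop} {H G K : MPStruct ι ar}
    (h : InclMinObs P H G) (hK : ¬ Hom K H) {f : K.carrier → G.carrier} (hf : IsHom K G f) :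
    Function.Surjective f := by
  by_contra hs
  simp only [Function.Surjective, not_forall, not_exists] at hs
  obtain ⟨v, hv⟩ := hs
  exact hK ((hf.hom_delete hv).trans (h.2.2 v))

/-- A core does not map to the structure obtained by deleting one of its elements. -/
theorem IsCore.not_hom_delete {G : MPStruct ι ar} (hG : IsCore G) (v : G.carrier) :
    ¬ Hom G (G.delete v) := by
  rintro ⟨f, hf⟩
  obtain ⟨x, hx⟩ := (hG _ ((isHom_delete_val G v).comp hf)).1.2 v
  exact (f x).2 hx

/-- for a `⋆`-structure `H`, `Obs_01^⊂(H) = Obs_01^→(H)`: a `01`-structure is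
an inclusion-minimal obstruction for `MP_01(H)` iff it is a hom-minimal obstruction. -/
theorem inclMin_eq_homMin_01 (H : MPStruct ι ar) (hH : H.isStar)
    (G : MPStruct ι ar) :
    InclMinObs MPStruct.is01 H G ↔ HomMinObs MPStruct.is01 H G := by
  constructor
  · intro h
    refine ⟨h.1, fun f hf => ⟨?_, hf.rel_eq h.1 h.1⟩, h.2.1, fun K hK ⟨f, hf⟩ hGK => ?_⟩
    · exact Finite.surjective_iff_bijective.mp (h.surjective h.2.1 hf)
    · by_contra hKH
      exact hGK (hf.hom_of_surjective hK h.1 (h.surjective hKH hf))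
  · rintro ⟨h01, hcore, hGH, hmin⟩
    exact ⟨h01, hGH, fun v =>
      hmin _ (h01.delete v) ⟨_, isHom_delete_val G v⟩ (hcore.not_hom_delete v)⟩
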